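/- arXiv:1406.5231 — 3 statements merged into one kernel-verified Lean document; each statement's English description precedes it below -/
import Mathlib

section
/- Let f ∈ (0, 1/2), θ ≠ 0 with f + θ ∈ (0, 1/2), and x, x̂ ∈ ℝ. Then (1/N) g_N(θ) → (x² + x̂²)/2 as N → ∞; equivalently, if x x̂ > 0, this limit equals |x̂ x| + δ²/2 with δ = |x − x̂|. -/
open Finset Real Filter

/-- The single-tone cost
`g_N(θ) = Σ_{n<N} (x sin(2πfn) − x̂ sin(2π(f+θ)n))²`. -/
noncomputable def singleToneCost (x xHat f θ : ℝ) (N : ℕ) : ℝ :=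
  ∑ n ∈ Finset.range N,
    (x * Real.sin (2 * Real.pi * f * n) -
      xHat * Real.sin (2 * Real.pi * (f + θ) * n)) ^ 2

/-- The Cesàro means of `cos (a n)` tend to zero unless `a` is a multiple of `2π`. -/
theorem tendsto_mean_cos_zero {a : ℝ} (ha : Real.sin (a / 2) ≠ 0) :
    Filter.Tendsto (fun N : ℕ => (1 / (N : ℝ)) * ∑ n ∈ Finset.range N, Real.cos (a * n))
      Filter.atTop (nhds 0) := by
  have h_eq : ∀ N : ℕ, ∑ n ∈ Finset.range N, Real.cos (a * n) =
      Real.sin (N * a / 2) * Real.cos ((N - 1) * a / 2) / Real.sin (a / 2) := by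
    intro N
    rw [eq_div_iff ha, mul_comm]
    simpa using Real.sin_mul_sum_cos N a 0
  have h_bdd : ∀ N : ℕ, |∑ n ∈ Finset.range N, Real.cos (a * n)| ≤ 1 / |Real.sin (a / 2)| := by
    intro N
    rw [h_eq, abs_div, abs_mul]
    gcongr
    exact mul_le_one₀ (Real.abs_sin_le_one _) (abs_nonneg _) (Real.abs_cos_le_one _)
  simpa only [mul_comm] using
    bdd_le_mul_tendsto_zero' _ (Filter.Eventually.of_forall h_bdd)
      (tendsto_one_div_atTop_nhds_zero_nat (𝕜 := ℝ))

/-- The single-tone cost expanded into cosine sums. -/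
theorem singleToneCost_eq_sum_cos (x xHat f θ : ℝ) (N : ℕ) :
    singleToneCost x xHat f θ N = N * ((x ^ 2 + xHat ^ 2) / 2)
      - x ^ 2 / 2 * ∑ n ∈ Finset.range N, Real.cos (4 * Real.pi * f * n)
      - xHat ^ 2 / 2 * ∑ n ∈ Finset.range N, Real.cos (4 * Real.pi * (f + θ) * n)
      - x * xHat * ∑ n ∈ Finset.range N, Real.cos (2 * Real.pi * θ * n)
      + x * xHat * ∑ n ∈ Finset.range N, Real.cos (2 * Real.pi * (2 * f + θ) * n) := by
  have h_const : (N : ℝ) * ((x ^ 2 + xHat ^ 2) / 2) =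
      ∑ _n ∈ Finset.range N, (x ^ 2 + xHat ^ 2) / 2 := by simp
  rw [singleToneCost, h_const]
  simp only [Finset.mul_sum, ← Finset.sum_sub_distrib, ← Finset.sum_add_distrib]
  refine Finset.sum_congr rfl fun n _ => ?_
  set u := 2 * Real.pi * f * n with hu
  set v := 2 * Real.pi * (f + θ) * n with hv
  rw [show 4 * Real.pi * f * n = 2 * u by rw [hu]; ring,
    show 4 * Real.pi * (f + θ) * n = 2 * v by rw [hv]; ring,
    show 2 * Real.pi * θ * n = v - u by rw [hu, hv]; ring,
    show 2 * Real.pi * (2 * f + θ) * n = v + u by rw [hu, hv]; ring,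
    Real.cos_two_mul, Real.cos_two_mul, Real.cos_sub, Real.cos_add]
  linear_combination x ^ 2 * Real.sin_sq_add_cos_sq u + xHat ^ 2 * Real.sin_sq_add_cos_sq v

/-- For a fixed nonzero frequency perturbation `θ`,
`(1/N) g_N(θ) → (x² + x̂²)/2`; equivalently, if `x·x̂ > 0` this limit equals
`|x̂·x| + δ²/2` with `δ = |x − x̂|`. -/
theorem singleToneCost_fixed_perturbation (f θ x xHat : ℝ)
    (hf : f ∈ Set.Ioo (0 : ℝ) (1 / 2)) (hθ : θ ≠ 0)
    (hfθ : f + θ ∈ Set.Ioo (0 : ℝ) (1 / 2)) :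
    Filter.Tendsto (fun N : ℕ => (1 / (N : ℝ)) * singleToneCost x xHat f θ N)
      Filter.atTop (nhds ((x ^ 2 + xHat ^ 2) / 2)) ∧
    (x * xHat > 0 →
      (x ^ 2 + xHat ^ 2) / 2 = |xHat * x| + |x - xHat| ^ 2 / 2) := by
  obtain ⟨hf₀, hf₁⟩ := hf
  obtain ⟨hg₀, hg₁⟩ := hfθ
  refine ⟨?_, fun h => ?_⟩
  · have sin_ne {a t : ℝ} (hat : a = 2 * Real.pi * t) (h₀ : t ≠ 0) (h₁ : -1 < t) (h₂ : t < 1) :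
        Real.sin (a / 2) ≠ 0 := by
      rw [hat, show 2 * Real.pi * t / 2 = Real.pi * t by ring, Ne,
        Real.sin_eq_zero_iff_of_lt_of_lt (by nlinarith [Real.pi_pos]) (by nlinarith [Real.pi_pos])]
      exact mul_ne_zero Real.pi_ne_zero h₀
    have h_f := tendsto_mean_cos_zero (a := 4 * Real.pi * f)
      (sin_ne (t := 2 * f) (by ring) (by positivity) (by linarith) (by linarith))
    have h_g := tendsto_mean_cos_zero (a := 4 * Real.pi * (f + θ))
      (sin_ne (t := 2 * (f + θ)) (by ring) (by positivity) (by linarith) (by linarith))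
    have h_diff := tendsto_mean_cos_zero (a := 2 * Real.pi * θ)
      (sin_ne rfl hθ (by linarith) (by linarith))
    have h_sum := tendsto_mean_cos_zero (a := 2 * Real.pi * (2 * f + θ))
      (sin_ne rfl (by linarith) (by linarith) (by linarith))
    have h_lim := ((((tendsto_const_nhds (x := (x ^ 2 + xHat ^ 2) / 2)).sub
      (h_f.const_mul (x ^ 2 / 2))).sub (h_g.const_mul (xHat ^ 2 / 2))).sub
      (h_diff.const_mul (x * xHat))).add (h_sum.const_mul (x * xHat))
    simp only [mul_zero, sub_zero, add_zero] at h_lim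
    refine h_lim.congr' ?_
    filter_upwards [Filter.eventually_ne_atTop 0] with N hN
    have hN' : (N : ℝ) ≠ 0 := Nat.cast_ne_zero.mpr hN
    rw [singleToneCost_eq_sum_cos]
    field_simp
  · rw [sq_abs, abs_of_pos (by linarith)]
    ring
end

section
/- For every real u with 0 < u ≤ 2.08, one has (2 − u²) sin u − 2u cos u < 0. -/
open Real

/-- A function vanishing at `0` with nonnegative derivative on `[0, ∞)` is nonnegative there. -/
lemma nonneg_of_hasDerivAt_nonneg {f f' : ℝ → ℝ} (hf : ∀ x, HasDerivAt f (f' x) x)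
    (h0 : f 0 = 0) (hf' : ∀ x, 0 ≤ x → 0 ≤ f' x) {x : ℝ} (hx : 0 ≤ x) : 0 ≤ f x := by
  have hmono : MonotoneOn f (Set.Ici 0) := by
    refine monotoneOn_of_hasDerivWithinAt_nonneg (convex_Ici 0)
      (fun y _ ↦ (hf y).continuousAt.continuousWithinAt)
      (fun y _ ↦ (hf y).hasDerivWithinAt) fun y hy ↦ hf' y ?_
    rw [interior_Ici] at hy
    exact le_of_lt hy
  simpa [h0] using hmono Set.self_mem_Ici hx hx

/-- The Taylor polynomial of `sin` of degree `2 n + 1` at `0`. -/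
noncomputable def sinTaylor (n : ℕ) (x : ℝ) : ℝ :=
  ∑ k ∈ Finset.range (n + 1), (-1) ^ k * x ^ (2 * k + 1) / (2 * k + 1).factorial

/-- The Taylor polynomial of `cos` of degree `2 n` at `0`. -/
noncomputable def cosTaylor (n : ℕ) (x : ℝ) : ℝ :=
  ∑ k ∈ Finset.range (n + 1), (-1) ^ k * x ^ (2 * k) / (2 * k).factorial

lemma hasDerivAt_sinTaylor (n : ℕ) (x : ℝ) :
    HasDerivAt (sinTaylor n) (cosTaylor n x) x := by
  unfold sinTaylor cosTaylor
  refine HasDerivAt.fun_sum fun k _ ↦ ?_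
  refine HasDerivAt.congr_deriv
    (((hasDerivAt_pow (2 * k + 1) x).const_mul ((-1 : ℝ) ^ k)).div_const
      ((2 * k + 1).factorial : ℝ)) ?_
  rw [Nat.factorial_succ]
  push_cast
  have : (2 * (k : ℝ) + 1) ≠ 0 := by positivity
  field_simp

lemma cosTaylor_succ (n : ℕ) (x : ℝ) : cosTaylor (n + 1) x =
    (∑ k ∈ Finset.range (n + 1), (-1) ^ (k + 1) * x ^ (2 * k + 2) / (2 * k + 2).factorial) + 1 := by
  rw [cosTaylor, Finset.sum_range_succ']
  simp [mul_add]

lemma hasDerivAt_cosTaylor_succ (n : ℕ) (x : ℝ) :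
    HasDerivAt (cosTaylor (n + 1)) (-sinTaylor n x) x := by
  rw [funext (cosTaylor_succ n), sinTaylor, ← Finset.sum_neg_distrib]
  refine (HasDerivAt.fun_sum fun k _ ↦ ?_).add_const 1
  refine HasDerivAt.congr_deriv
    (((hasDerivAt_pow (2 * k + 2) x).const_mul ((-1 : ℝ) ^ (k + 1))).div_const
      ((2 * k + 2).factorial : ℝ)) ?_
  rw [Nat.factorial_succ (2 * k + 1)]
  push_cast
  have : (2 * (k : ℝ) + 1 + 1) ≠ 0 := by positivity
  field_simp
  ring

lemma sin_alternating_of_cos_alternating {n : ℕ}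
    (h : ∀ x : ℝ, 0 ≤ x → 0 ≤ (-1) ^ n * (cosTaylor n x - cos x)) {x : ℝ} (hx : 0 ≤ x) :
    0 ≤ (-1) ^ n * (sinTaylor n x - sin x) :=
  nonneg_of_hasDerivAt_nonneg
    (fun y ↦ ((hasDerivAt_sinTaylor n y).sub (hasDerivAt_sin y)).const_mul ((-1 : ℝ) ^ n))
    (by simp [sinTaylor]) h hx

/-- The Taylor polynomials of `cos` at `0` alternately over- and underestimate it. -/
lemma cos_alternating (n : ℕ) {x : ℝ} (hx : 0 ≤ x) :
    0 ≤ (-1) ^ n * (cosTaylor n x - cos x) := by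
  induction n generalizing x with
  | zero => simp [cosTaylor, cos_le_one]
  | succ n ih =>
    refine nonneg_of_hasDerivAt_nonneg
      (fun y ↦ ((hasDerivAt_cosTaylor_succ n y).sub (hasDerivAt_cos y)).const_mul
        ((-1 : ℝ) ^ (n + 1)))
      (by simp [cosTaylor_succ]) (fun y hy ↦ ?_) hx
    have := sin_alternating_of_cos_alternating (fun z hz ↦ ih hz) hy
    rw [pow_succ]
    linarith

lemma taylor_ten_le_cos {x : ℝ} (hx : 0 ≤ x) :
    1 - x ^ 2 / 2 + x ^ 4 / 24 - x ^ 6 / 720 + x ^ 8 / 40320 - x ^ 10 / 3628800 ≤ cos x := by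
  have h := cos_alternating 5 hx
  simp only [cosTaylor, Finset.sum_range_succ, Finset.sum_range_zero, Nat.factorial] at h
  norm_num at h
  linarith

lemma hasDerivAt_sinc_second_deriv_numerator (x : ℝ) :
    HasDerivAt (fun u ↦ (2 - u ^ 2) * sin u - 2 * u * cos u) (-x ^ 2 * cos x) x := by
  refine HasDerivAt.congr_deriv
    ((((hasDerivAt_pow 2 x).const_sub 2).mul (hasDerivAt_sin x)).sub
      (((hasDerivAt_id x).const_mul 2).mul (hasDerivAt_cos x))) ?_
  simp
  ring

lemma sinc_second_deriv_numerator_le {x : ℝ} (hx : 0 ≤ x) :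
    (2 - x ^ 2) * sin x - 2 * x * cos x ≤
      -x ^ 3 / 3 + x ^ 5 / 10 - x ^ 7 / 168 + x ^ 9 / 6480 - x ^ 11 / 443520
        + x ^ 13 / 47174400 := by
  have hp (y : ℝ) : HasDerivAt (fun u : ℝ ↦ u ^ 5 / 10 - u ^ 3 / 3 - u ^ 7 / 168 + u ^ 9 / 6480
      - u ^ 11 / 443520 + u ^ 13 / 47174400)
      (-y ^ 2 * (1 - y ^ 2 / 2 + y ^ 4 / 24 - y ^ 6 / 720 + y ^ 8 / 40320
        - y ^ 10 / 3628800)) y := by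
    refine HasDerivAt.congr_deriv
        (((((((hasDerivAt_pow 5 y).div_const 10).sub
        ((hasDerivAt_pow 3 y).div_const 3)).sub
        ((hasDerivAt_pow 7 y).div_const 168)).add
        ((hasDerivAt_pow 9 y).div_const 6480)).sub
        ((hasDerivAt_pow 11 y).div_const 443520)).add
        ((hasDerivAt_pow 13 y).div_const 47174400)) ?_
    norm_num
    ring
  have := nonneg_of_hasDerivAt_nonneg
    (fun y ↦ (hp y).sub (hasDerivAt_sinc_second_deriv_numerator y)) (by simp)
    (fun y hy ↦ by nlinarith [mul_nonneg (sq_nonneg y) (sub_nonneg.2 (taylor_ten_le_cos hy))]) hx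
  simp only [Pi.sub_apply] at this
  linarith

/-- The polynomial obtained from the Taylor upper bound after dividing by `u ^ 3` and
substituting `t = u ^ 2` is negative up to `t = 2.08 ^ 2`. -/
lemma taylor_bound_quotient_neg {t : ℝ} (ht0 : 0 ≤ t) (ht : t ≤ 4.3264) :
    -1 / 3 + t / 10 - t ^ 2 / 168 + t ^ 3 / 6480 - t ^ 4 / 443520 + t ^ 5 / 47174400 < 0 := by
  have hquad : t / 10 - t ^ 2 / 168 ≤ 4.3264 / 10 - 4.3264 ^ 2 / 168
      - (4.3264 - t) * (1 / 25) := by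
    nlinarith
  have hcube : t ^ 3 ≤ 4.3264 ^ 3 := by gcongr
  have hquart : 4.3264 ^ 4 - t ^ 4 ≤ (4.3264 - t) * (4 * 4.3264 ^ 3) := by
    have h2 : t ^ 2 ≤ 4.3264 ^ 2 := by gcongr
    have := mul_nonneg (sub_nonneg.2 ht) (by linarith :
      (0 : ℝ) ≤ 4 * 4.3264 ^ 3 - (4.3264 ^ 3 + 4.3264 ^ 2 * t + 4.3264 * t ^ 2 + t ^ 3))
    linarith
  have hquint : t ^ 5 ≤ 4.3264 ^ 5 := by gcongr
  norm_num at *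
  linarith

/-- For `0 < u ≤ 2.08`, the quantity `(2 − u²) sin u − 2u cos u`
(which is `u³ · sinc''(u)`) is negative. -/
theorem sinc_second_deriv_numerator_neg (u : ℝ) (hu0 : 0 < u)
    (hu : u ≤ 2.08) :
    (2 - u ^ 2) * Real.sin u - 2 * u * Real.cos u < 0 := by
  have hq := taylor_bound_quotient_neg (sq_nonneg u) (by norm_num at *; nlinarith)
  have := mul_neg_of_pos_of_neg (pow_pos hu0 3) hq
  linarith [sinc_second_deriv_numerator_le hu0.le]
end

section
/- Every u ∈ (0, π) satisfying (2 − u²) sin u = 2u cos u lies in the open interval (2.08, 2.09); consequently the corresponding value Q = π/u satisfies 1.503 < Q < 1.511. -/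
open Real

lemma sin_two_pi_div_three_sub (w : ℝ) :
    sin (2 * π / 3 - w) = √3 / 2 * cos w + 1 / 2 * sin w := by
  rw [show 2 * π / 3 - w = π - (π / 3 + w) by ring, sin_pi_sub, sin_add, sin_pi_div_three,
    cos_pi_div_three]

lemma cos_two_pi_div_three_sub (w : ℝ) :
    cos (2 * π / 3 - w) = √3 / 2 * sin w - 1 / 2 * cos w := by
  rw [show 2 * π / 3 - w = π - (π / 3 + w) by ring, cos_pi_sub, cos_add, sin_pi_div_three,
    cos_pi_div_three]
  ring

lemma sqrt_three_bounds : 1.732 < √3 ∧ √3 < 1.7321 :=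
  ⟨lt_sqrt_of_sq_lt (by norm_num), (sqrt_lt' (by norm_num)).2 (by norm_num)⟩

lemma sin_cos_lower_bounds_at_left_endpoint :
    0.873 < sin 2.08 ∧ -0.4877 < cos 2.08 := by
  obtain ⟨w, hw⟩ : ∃ w, w = 2 * π / 3 - 2.08 := ⟨_, rfl⟩
  have hw₁ : 0.01439 < w := by linarith [pi_gt_d6]
  have hw₂ : w < 0.0144 := by linarith [pi_lt_d6]
  have hcos : 0.9998 < cos w := by
    nlinarith [one_sub_sq_div_two_le_cos (x := w)]
  have hsin : 0.01438 < sin w := by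
    have hcube : w ^ 3 ≤ 0.0144 ^ 3 := by gcongr
    linarith [sin_gt_sub_cube (x := w) (by linarith)]
  have hsqrt := sqrt_three_bounds.1
  rw [show (2.08 : ℝ) = 2 * π / 3 - w by linarith, sin_two_pi_div_three_sub,
    cos_two_pi_div_three_sub]
  constructor
  · nlinarith
  · nlinarith [cos_le_one w]

lemma sin_cos_upper_bounds_at_right_endpoint :
    sin 2.09 < 0.8683 ∧ cos 2.09 < -0.4961 := by
  obtain ⟨w, hw⟩ : ∃ w, w = 2 * π / 3 - 2.09 := ⟨_, rfl⟩
  have hw₁ : 0.00439 < w := by linarith [pi_gt_d6]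
  have hw₂ : w < 0.0044 := by linarith [pi_lt_d6]
  have hcos : 0.99999 < cos w := by
    nlinarith [one_sub_sq_div_two_le_cos (x := w)]
  have hsin : sin w < 0.0044 := (sin_lt (by linarith)).trans hw₂
  have hsqrt := sqrt_three_bounds.2
  have hsqrt_nonneg := sqrt_nonneg 3
  rw [show (2.09 : ℝ) = 2 * π / 3 - w by linarith, sin_two_pi_div_three_sub,
    cos_two_pi_div_three_sub]
  constructor
  · nlinarith [cos_le_one w]
  · nlinarith

lemma hasDerivAt_two_sub_sq_mul_sin_sub (x : ℝ) :
    HasDerivAt (fun u : ℝ => (2 - u ^ 2) * sin u - 2 * u * cos u) (-(x ^ 2 * cos x)) x := by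
  have h := ((((hasDerivAt_id x).pow 2).const_sub 2).mul (hasDerivAt_sin x)).sub
    (((hasDerivAt_id x).const_mul 2).mul (hasDerivAt_cos x))
  refine h.congr_deriv ?_
  simp
  ring

lemma strictAntiOn_two_sub_sq_mul_sin_sub :
    StrictAntiOn (fun u : ℝ => (2 - u ^ 2) * sin u - 2 * u * cos u) (Set.Icc 0 (π / 2)) := by
  refine strictAntiOn_of_deriv_neg (convex_Icc _ _) (by fun_prop) fun x hx => ?_
  rw [interior_Icc] at hx
  rw [(hasDerivAt_two_sub_sq_mul_sin_sub x).deriv]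
  have := mul_pos (pow_pos hx.1 2) (cos_pos_of_mem_Ioo ⟨by linarith [hx.1, pi_pos], hx.2⟩)
  linarith

lemma strictMonoOn_two_sub_sq_mul_sin_sub :
    StrictMonoOn (fun u : ℝ => (2 - u ^ 2) * sin u - 2 * u * cos u) (Set.Icc (π / 2) π) := by
  refine strictMonoOn_of_deriv_pos (convex_Icc _ _) (by fun_prop) fun x hx => ?_
  rw [interior_Icc] at hx
  rw [(hasDerivAt_two_sub_sq_mul_sin_sub x).deriv]
  have hx₀ : 0 < x := by linarith [hx.1, pi_pos]
  have := mul_neg_of_pos_of_neg (pow_pos hx₀ 2)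
    (cos_neg_of_pi_div_two_lt_of_lt hx.1 (by linarith [hx.2, pi_pos]))
  linarith

/-- Every root of `(2 − u²) sin u = 2u cos u` in `(0, π)` lies in
`(2.08, 2.09)`; consequently `Q = π/u` satisfies `1.503 < Q < 1.511`. -/
theorem transcendental_root_location (u : ℝ)
    (hu : u ∈ Set.Ioo (0 : ℝ) Real.pi)
    (heq : (2 - u ^ 2) * Real.sin u = 2 * u * Real.cos u) :
    u ∈ Set.Ioo (2.08 : ℝ) 2.09 ∧
      (1.503 : ℝ) < Real.pi / u ∧ Real.pi / u < 1.511 := by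
  obtain ⟨hu₀, huπ⟩ := hu
  have hπ₁ := pi_gt_d6
  have hπ₂ := pi_lt_d6
  have hhalf : π / 2 < u := by
    by_contra! h
    have := strictAntiOn_two_sub_sq_mul_sin_sub ⟨le_rfl, by linarith⟩ ⟨hu₀.le, h⟩ hu₀
    norm_num at this
    linarith
  have hmem : u ∈ Set.Icc (π / 2) π := ⟨hhalf.le, huπ.le⟩
  have hleft : 2.08 < u := by
    have := sin_cos_lower_bounds_at_left_endpoint
    refine (strictMonoOn_two_sub_sq_mul_sin_sub.lt_iff_lt
      ⟨by linarith, by linarith⟩ hmem).1 ?_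
    linarith
  have hright : u < 2.09 := by
    have := sin_cos_upper_bounds_at_right_endpoint
    refine (strictMonoOn_two_sub_sq_mul_sin_sub.lt_iff_lt hmem
      ⟨by linarith, by linarith⟩).1 ?_
    linarith
  refine ⟨⟨hleft, hright⟩, ?_, ?_⟩
  · rw [lt_div_iff₀ hu₀]
    linarith
  · rw [div_lt_iff₀ hu₀]
    linarith
end
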